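/- arXiv:nlin/0107065 — 2 statements merged into one kernel-verified Lean document; each statement's English description precedes it below -/
import Mathlib

section
/- Let n ≥ 1, let w : ℝ⁴ → Matrix (Fin n) (Fin n) ℂ be smooth, and for λ ∈ ℂ define the first-order operators L(λ) and M(λ) acting on smooth maps Ψ : ℝ⁴ → Matrix (Fin n) (Fin n) ℂ by L(λ)Ψ := ∂_z̄Ψ − λ∂_yΨ + (∂_y w)·Ψ and M(λ)Ψ := ∂_ȳΨ + λ∂_zΨ − (∂_z w)·Ψ. Then for every λ ∈ ℂ and every smooth Ψ, L(λ)(M(λ)Ψ) − M(λ)(L(λ)Ψ) = −((∂_y∂_ȳ w + ∂_z∂_z̄ w) + [∂_y w, ∂_z w])·Ψ, where [A,B] := AB − BA; in particular the λ-dependent terms cancel identically, and L(λ) and M(λ) commute for all λ if and only if w satisfies (∂_y∂_ȳ + ∂_z∂_z̄)w + [∂_y w, ∂_z w] = 0. -/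
/-- Partial derivative of a matrix-valued function on `ℝ⁴` with respect to
coordinate `u`, taken entrywise. Coordinates: `0 = y`, `1 = z`, `2 = ȳ`, `3 = z̄`. -/
noncomputable def pd {n : ℕ} (u : Fin 4) (A : (Fin 4 → ℝ) → Matrix (Fin n) (Fin n) ℂ)
    (p : Fin 4 → ℝ) : Matrix (Fin n) (Fin n) ℂ :=
  Matrix.of fun i j => deriv (fun t => A (Function.update p u t) i j) (p u)

/-- All matrix entries are `C^∞`. -/
def IsSmoothMat {n : ℕ} (A : (Fin 4 → ℝ) → Matrix (Fin n) (Fin n) ℂ) : Prop :=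
  ∀ i j, ContDiff ℝ (⊤ : ℕ∞) fun p => A p i j

open scoped ContDiff

section PartialDerivatives

variable {n : ℕ} {A B : (Fin 4 → ℝ) → Matrix (Fin n) (Fin n) ℂ}

theorem IsSmoothMat.differentiable (hA : IsSmoothMat A) (i j : Fin n) :
    Differentiable ℝ fun p => A p i j :=
  (hA i j).differentiable (by simp)

theorem IsSmoothMat.pd_apply (hA : IsSmoothMat A) (u : Fin 4) (p : Fin 4 → ℝ) (i j : Fin n) :
    pd u A p i j = fderiv ℝ (fun q => A q i j) p (Pi.single u 1) := by
  have h : HasFDerivAt (fun q => A q i j) (fderiv ℝ (fun q => A q i j) p)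
      (Function.update p u (p u)) := by
    rw [Function.update_eq_self]
    exact (hA.differentiable i j p).hasFDerivAt
  exact (h.comp_hasDerivAt (p u) (hasDerivAt_update p u (p u))).deriv

theorem IsSmoothMat.pd (hA : IsSmoothMat A) (u : Fin 4) : IsSmoothMat (pd u A) := by
  intro i j
  simp only [hA.pd_apply]
  exact ((hA i j).fderiv_right (m := ∞) (by simp)).clm_apply contDiff_const

theorem IsSmoothMat.add (hA : IsSmoothMat A) (hB : IsSmoothMat B) :
    IsSmoothMat fun p => A p + B p :=
  fun i j => (hA i j).add (hB i j)

theorem IsSmoothMat.sub (hA : IsSmoothMat A) (hB : IsSmoothMat B) :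
    IsSmoothMat fun p => A p - B p :=
  fun i j => (hA i j).sub (hB i j)

theorem IsSmoothMat.const_smul (c : ℂ) (hA : IsSmoothMat A) : IsSmoothMat fun p => c • A p :=
  fun i j => contDiff_const.mul (hA i j)

theorem IsSmoothMat.mul (hA : IsSmoothMat A) (hB : IsSmoothMat B) :
    IsSmoothMat fun p => A p * B p := by
  intro i j
  simp only [Matrix.mul_apply]
  exact ContDiff.sum fun k _ => (hA i k).mul (hB k j)

theorem isSmoothMat_const (C : Matrix (Fin n) (Fin n) ℂ) : IsSmoothMat fun _ => C :=
  fun _ _ => contDiff_const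

theorem pd_add (hA : IsSmoothMat A) (hB : IsSmoothMat B) (u : Fin 4) (p : Fin 4 → ℝ) :
    pd u (fun q => A q + B q) p = pd u A p + pd u B p := by
  ext i j
  rw [(hA.add hB).pd_apply, Matrix.add_apply, hA.pd_apply, hB.pd_apply]
  simp only [Matrix.add_apply]
  rw [fderiv_fun_add (hA.differentiable i j p) (hB.differentiable i j p)]
  rfl

theorem pd_sub (hA : IsSmoothMat A) (hB : IsSmoothMat B) (u : Fin 4) (p : Fin 4 → ℝ) :
    pd u (fun q => A q - B q) p = pd u A p - pd u B p := by
  ext i j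
  rw [(hA.sub hB).pd_apply, Matrix.sub_apply, hA.pd_apply, hB.pd_apply]
  simp only [Matrix.sub_apply]
  rw [fderiv_fun_sub (hA.differentiable i j p) (hB.differentiable i j p)]
  rfl

theorem pd_const_smul (c : ℂ) (hA : IsSmoothMat A) (u : Fin 4) (p : Fin 4 → ℝ) :
    pd u (fun q => c • A q) p = c • pd u A p := by
  ext i j
  rw [(hA.const_smul c).pd_apply, Matrix.smul_apply, hA.pd_apply]
  simp only [Matrix.smul_apply]
  rw [fderiv_fun_const_smul (hA.differentiable i j p)]
  rfl

theorem pd_mul (hA : IsSmoothMat A) (hB : IsSmoothMat B) (u : Fin 4) (p : Fin 4 → ℝ) :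
    pd u (fun q => A q * B q) p = pd u A p * B p + A p * pd u B p := by
  ext i j
  rw [(hA.mul hB).pd_apply]
  simp only [Matrix.add_apply, Matrix.mul_apply, hA.pd_apply, hB.pd_apply]
  rw [fderiv_fun_sum fun k _ => (hA.differentiable i k p).fun_mul (hB.differentiable k j p),
    ← Finset.sum_add_distrib, sum_apply]
  refine Finset.sum_congr rfl fun k _ => ?_
  rw [fderiv_fun_mul (hA.differentiable i k p) (hB.differentiable k j p)]
  simp only [add_apply, smul_apply, smul_eq_mul]
  ring

theorem pd_comm (hA : IsSmoothMat A) (u v : Fin 4) (p : Fin 4 → ℝ) :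
    pd u (pd v A) p = pd v (pd u A) p := by
  ext i j
  have hd : DifferentiableAt ℝ (fderiv ℝ fun q => A q i j) p :=
    ((hA i j).fderiv_right (m := ∞) (by simp)).differentiable (by simp) p
  have hsymm : IsSymmSndFDerivAt ℝ (fun q => A q i j) p :=
    (hA i j).contDiffAt.isSymmSndFDerivAt
      (by simpa using WithTop.coe_le_coe.2 (le_top : (2 : ℕ∞) ≤ ⊤))
  rw [(hA.pd v).pd_apply, (hA.pd u).pd_apply]
  simp only [hA.pd_apply]
  rw [fderiv_clm_apply hd (differentiableAt_const _),
    fderiv_clm_apply hd (differentiableAt_const _)]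
  simpa using hsymm (Pi.single u 1) (Pi.single v 1)

end PartialDerivatives

/-- The Lax pair `L(λ) = ∂_z̄ − λ∂_y + (∂_y w)·`, `M(λ) = ∂_ȳ + λ∂_z − (∂_z w)·` of the
potential form of SDYM: the commutator is `λ`-independent and `L(λ)`, `M(λ)` commute
for all `λ` iff `(∂_y∂_ȳ + ∂_z∂_z̄)w + [∂_y w, ∂_z w] = 0`. -/
theorem stmt3 {n : ℕ} (hn : 1 ≤ n)
    (w : (Fin 4 → ℝ) → Matrix (Fin n) (Fin n) ℂ) (hw : IsSmoothMat w)
    (L M : ℂ → ((Fin 4 → ℝ) → Matrix (Fin n) (Fin n) ℂ) →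
      (Fin 4 → ℝ) → Matrix (Fin n) (Fin n) ℂ)
    (hL : ∀ lam Ψ p, L lam Ψ p = pd 3 Ψ p - lam • pd 0 Ψ p + pd 0 w p * Ψ p)
    (hM : ∀ lam Ψ p, M lam Ψ p = pd 2 Ψ p + lam • pd 1 Ψ p - pd 1 w p * Ψ p) :
    (∀ (lam : ℂ) (Ψ : (Fin 4 → ℝ) → Matrix (Fin n) (Fin n) ℂ), IsSmoothMat Ψ → ∀ p,
      L lam (M lam Ψ) p - M lam (L lam Ψ) p
        = -(((pd 0 (pd 2 w) p + pd 1 (pd 3 w) p)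
            + (pd 0 w p * pd 1 w p - pd 1 w p * pd 0 w p)) * Ψ p))
    ∧ ((∀ (lam : ℂ) (Ψ : (Fin 4 → ℝ) → Matrix (Fin n) (Fin n) ℂ), IsSmoothMat Ψ → ∀ p,
          L lam (M lam Ψ) p = M lam (L lam Ψ) p)
        ↔ ∀ p, (pd 0 (pd 2 w) p + pd 1 (pd 3 w) p)
            + (pd 0 w p * pd 1 w p - pd 1 w p * pd 0 w p) = 0) := by
  have key : ∀ (lam : ℂ) (Ψ : (Fin 4 → ℝ) → Matrix (Fin n) (Fin n) ℂ), IsSmoothMat Ψ → ∀ p,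
      L lam (M lam Ψ) p - M lam (L lam Ψ) p
        = -(((pd 0 (pd 2 w) p + pd 1 (pd 3 w) p)
            + (pd 0 w p * pd 1 w p - pd 1 w p * pd 0 w p)) * Ψ p) := by
    intro lam Ψ hΨ p
    have pd_L (u : Fin 4) : pd u (L lam Ψ) p = pd u (pd 3 Ψ) p - lam • pd u (pd 0 Ψ) p
        + (pd u (pd 0 w) p * Ψ p + pd 0 w p * pd u Ψ p) := by
      rw [funext (hL lam Ψ), pd_add ((hΨ.pd 3).sub ((hΨ.pd 0).const_smul lam)) ((hw.pd 0).mul hΨ),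
        pd_sub (hΨ.pd 3) ((hΨ.pd 0).const_smul lam), pd_const_smul lam (hΨ.pd 0),
        pd_mul (hw.pd 0) hΨ]
    have pd_M (u : Fin 4) : pd u (M lam Ψ) p = pd u (pd 2 Ψ) p + lam • pd u (pd 1 Ψ) p
        - (pd u (pd 1 w) p * Ψ p + pd 1 w p * pd u Ψ p) := by
      rw [funext (hM lam Ψ), pd_sub ((hΨ.pd 2).add ((hΨ.pd 1).const_smul lam)) ((hw.pd 1).mul hΨ),
        pd_add (hΨ.pd 2) ((hΨ.pd 1).const_smul lam), pd_const_smul lam (hΨ.pd 1),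
        pd_mul (hw.pd 1) hΨ]
    rw [hL lam (M lam Ψ), hM lam (L lam Ψ), pd_M, pd_M, pd_L, pd_L, hL, hM,
      pd_comm hΨ 3 2, pd_comm hΨ 3 1, pd_comm hΨ 0 2, pd_comm hΨ 0 1,
      pd_comm hw 3 1, pd_comm hw 0 1, pd_comm hw 0 2]
    simp only [smul_add, smul_sub, mul_add, mul_sub, add_mul, sub_mul, mul_smul_comm, mul_assoc]
    abel
  refine ⟨key, fun h p => ?_, fun h lam Ψ hΨ p => ?_⟩
  · have h1 := key 0 (fun _ => 1) (isSmoothMat_const 1) p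
    rw [h 0 _ (isSmoothMat_const 1) p, sub_self, mul_one] at h1
    exact neg_eq_zero.mp h1.symm
  · rw [← sub_eq_zero, key lam Ψ hΨ p, h p, zero_mul, neg_zero]
end

section
/- Let N ≥ 1 and let ξ₀, …, ξ_N ∈ Matrix (Fin 2) (Fin 2N) ℂ be such that the 2N × 2N matrix obtained by stacking ξ_{N−1}, …, ξ₁, ξ₀ vertically is invertible, and let w₁, …, w_N ∈ Matrix (Fin 2) (Fin 2) ℂ be the unique matrices with ξ_N + Σ_{m=1}^{N} w_m·ξ_{N−m} = 0. Suppose there exists an invertible P₂ ∈ Matrix (Fin 2N) (Fin 2N) ℂ such that, with P₁ := the 2×2 matrix with rows (0, 1) and (−1, 0), the entrywise complex conjugate of ξ_j equals P₁·ξ_j·P₂ for every j = 0, …, N. Then for every m = 1, …, N the entries of w_m satisfy (w_m)₂₂ = conj((w_m)₁₁) and (w_m)₂₁ = −conj((w_m)₁₂). -/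
/-- The `2N × 2N` matrix obtained by stacking the `2 × 2N` blocks
`ξ_{N−1}, ξ_{N−2}, …, ξ₁, ξ₀` vertically (in this order): rows `2k, 2k+1` are the two
rows of `ξ_{N−1−k}`. -/
def stackMat (N : ℕ) (ξ : ℕ → Matrix (Fin 2) (Fin (2 * N)) ℂ) :
    Matrix (Fin (2 * N)) (Fin (2 * N)) ℂ :=
  Matrix.of fun i j => ξ (N - 1 - (i : ℕ) / 2) ⟨(i : ℕ) % 2, Nat.mod_lt _ (by norm_num)⟩ j

theorem vecMul_stackMat (N : ℕ) (ξ : ℕ → Matrix (Fin 2) (Fin (2 * N)) ℂ)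
    (v : Fin N → Matrix (Fin 2) (Fin 2) ℂ) (a : Fin 2) :
    Matrix.vecMul (fun i : Fin (2 * N) => v ⟨(i : ℕ) / 2, by omega⟩ a
        ⟨(i : ℕ) % 2, Nat.mod_lt _ (by norm_num)⟩) (stackMat N ξ)
      = (∑ m : Fin N, v m * ξ (N - 1 - (m : ℕ))) a := by
  ext j
  simp only [Matrix.vecMul, dotProduct, Matrix.sum_apply, Matrix.mul_apply, stackMat,
    Matrix.of_apply]
  rw [← Fintype.sum_prod_type', ← (finProdFinEquiv.trans (finCongr (mul_comm N 2))).sum_comp]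
  refine Finset.sum_congr rfl fun p _ => ?_
  obtain ⟨m, b⟩ := p
  have hdiv : ((b : ℕ) + 2 * m) / 2 = m := by omega
  have hmod : ((b : ℕ) + 2 * m) % 2 = b := by omega
  simp [hdiv, hmod]

theorem eq_zero_of_sum_mul_eq_zero {N : ℕ} {ξ : ℕ → Matrix (Fin 2) (Fin (2 * N)) ℂ}
    (hinv : IsUnit (stackMat N ξ)) {v : Fin N → Matrix (Fin 2) (Fin 2) ℂ}
    (hv : ∑ m : Fin N, v m * ξ (N - 1 - (m : ℕ)) = 0) (m : Fin N) : v m = 0 := by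
  ext a b
  have hx := vecMul_stackMat N ξ v a
  rw [hv] at hx
  have h0 := Matrix.vecMul_injective_of_isUnit hinv (hx.trans (Matrix.zero_vecMul _).symm)
  have hdiv : ((b : ℕ) + 2 * m) / 2 = m := by omega
  have hmod : ((b : ℕ) + 2 * m) % 2 = b := by omega
  simpa [hdiv, hmod] using congrFun h0 ⟨b + 2 * m, by omega⟩

/-- Reality condition for the (2+1)-dimensional NLS hierarchy: with
`P₁ = [[0,1],[−1,0]]`, if `conj ξ_j = P₁ ξ_j P₂`, then the unique solution `w` of the
residue condition satisfies `(w_m)₂₂ = conj (w_m)₁₁` and `(w_m)₂₁ = − conj (w_m)₁₂`. -/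
theorem stmt9 (N : ℕ) (hN : 1 ≤ N) (ξ : ℕ → Matrix (Fin 2) (Fin (2 * N)) ℂ)
    (hinv : IsUnit (stackMat N ξ))
    (w : Fin N → Matrix (Fin 2) (Fin 2) ℂ)
    (hw : ξ N + ∑ m : Fin N, w m * ξ (N - 1 - (m : ℕ)) = 0)
    (P1 : Matrix (Fin 2) (Fin 2) ℂ) (hP1 : P1 = !![0, 1; -1, 0])
    (P2 : Matrix (Fin (2 * N)) (Fin (2 * N)) ℂ) (hP2 : IsUnit P2)
    (hconj : ∀ j ≤ N, (ξ j).map (starRingEnd ℂ) = P1 * ξ j * P2) :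
    ∀ m : Fin N, w m 1 1 = (starRingEnd ℂ) (w m 0 0)
      ∧ w m 1 0 = - (starRingEnd ℂ) (w m 0 1) := by
  have hconj_sum : P1 * ξ N + ∑ m : Fin N,
      (w m).map (starRingEnd ℂ) * P1 * ξ (N - 1 - (m : ℕ)) = 0 := by
    have h := congrArg (fun A => A.map (starRingEnd ℂ)) hw
    have hsum : (∑ m : Fin N, w m * ξ (N - 1 - (m : ℕ))).map (starRingEnd ℂ)
        = ∑ m : Fin N, (w m * ξ (N - 1 - (m : ℕ))).map (starRingEnd ℂ) :=
      map_sum (starRingEnd ℂ).toAddMonoidHom.mapMatrix _ _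
    have hterm (m : Fin N) : (w m * ξ (N - 1 - (m : ℕ))).map (starRingEnd ℂ)
        = (w m).map (starRingEnd ℂ) * P1 * ξ (N - 1 - (m : ℕ)) * P2 := by
      rw [Matrix.map_mul, hconj _ (by omega)]
      simp only [Matrix.mul_assoc]
    simp only [Matrix.map_add _ (map_add (starRingEnd ℂ)), hsum, hterm, hconj N le_rfl,
      ← Matrix.sum_mul, ← Matrix.add_mul, Matrix.map_zero _ (map_zero (starRingEnd ℂ))] at h
    have hdet := (Matrix.isUnit_iff_isUnit_det P2).mp hP2
    rw [← Matrix.mul_nonsing_inv_cancel_right _ (P1 * ξ N + ∑ m : Fin N,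
      (w m).map (starRingEnd ℂ) * P1 * ξ (N - 1 - (m : ℕ))) hdet, h, Matrix.zero_mul]
  have hdiff : ∑ m : Fin N,
      (P1 * w m - (w m).map (starRingEnd ℂ) * P1) * ξ (N - 1 - (m : ℕ)) = 0 := by
    have h := congrArg (P1 * ·) hw
    simp only [Matrix.mul_add, Matrix.mul_sum, Matrix.mul_zero, ← Matrix.mul_assoc] at h
    simp only [Matrix.sub_mul, Finset.sum_sub_distrib]
    exact sub_eq_zero.mpr (add_left_cancel (h.trans hconj_sum.symm))
  intro m
  have hm := sub_eq_zero.mp (eq_zero_of_sum_mul_eq_zero hinv hdiff m)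
  have h00 := congrFun₂ hm 0 0
  have h01 := congrFun₂ hm 0 1
  simp [hP1, Matrix.mul_apply, Fin.sum_univ_two] at h00 h01
  exact ⟨h01, h00⟩
end
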